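/- Let D ⊆ ℝⁿ be a nonempty convex set and f : D → ℝ a locally Lipschitz function admitting a bounded convexificator ∂f(x) at every x ∈ D, and suppose f is ∂-convex on D. Then for all ω, v ∈ D with ω ≠ v there exist t̄ ∈ (0, 1) and ζ in the convex hull of ∂f(ω + t̄(v − ω)) such that ⟨ζ, v − ω⟩ ≤ f(v) − f(ω). -/

import Mathlib

open RealInnerProductSpace

/-- Lower Dini derivative of `f` at `x` in direction `w` (limit `λ → 0⁺`), valued in `EReal`. -/
noncomputable def diniLower {n : ℕ} (f : EuclideanSpace ℝ (Fin n) → ℝ)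
    (x w : EuclideanSpace ℝ (Fin n)) : EReal :=
  Filter.liminf (fun t : ℝ => (((f (x + t • w) - f x) / t : ℝ) : EReal))
    (nhdsWithin 0 (Set.Ioi 0))

/-- Upper Dini derivative of `f` at `x` in direction `w` (limit `λ → 0⁺`), valued in `EReal`. -/
noncomputable def diniUpperD {n : ℕ} (f : EuclideanSpace ℝ (Fin n) → ℝ)
    (x w : EuclideanSpace ℝ (Fin n)) : EReal :=
  Filter.limsup (fun t : ℝ => (((f (x + t • w) - f x) / t : ℝ) : EReal))
    (nhdsWithin 0 (Set.Ioi 0))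

/-- `S` is a convexificator of `f` at `x`. -/
def IsConvexificatorAt {n : ℕ} (f : EuclideanSpace ℝ (Fin n) → ℝ)
    (x : EuclideanSpace ℝ (Fin n)) (S : Set (EuclideanSpace ℝ (Fin n))) : Prop :=
  IsClosed S ∧
    (∀ w, diniLower f x w ≤ ⨆ ζ ∈ S, ((⟪ζ, w⟫ : ℝ) : EReal)) ∧
    (∀ w, (⨅ ζ ∈ S, ((⟪ζ, w⟫ : ℝ) : EReal)) ≤ diniUpperD f x w)

/-- `f` admits the bounded convexificator `sub x` at every point `x` of `D`. -/
def HasBoundedConvexificatorOn {n : ℕ} (D : Set (EuclideanSpace ℝ (Fin n)))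
    (f : EuclideanSpace ℝ (Fin n) → ℝ)
    (sub : EuclideanSpace ℝ (Fin n) → Set (EuclideanSpace ℝ (Fin n))) : Prop :=
  ∀ x ∈ D, IsConvexificatorAt f x (sub x) ∧ Bornology.IsBounded (sub x)

/-- `f` is locally Lipschitz on `D`. -/
def LocallyLipschitzOnD {n : ℕ} (D : Set (EuclideanSpace ℝ (Fin n)))
    (f : EuclideanSpace ℝ (Fin n) → ℝ) : Prop :=
  ∀ x ∈ D, ∃ M > (0 : ℝ), ∃ δ > (0 : ℝ), ∀ y ∈ D, ∀ z ∈ D,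
    ‖y - x‖ < δ → ‖z - x‖ < δ → |f y - f z| ≤ M * ‖y - z‖

/-- `f` is `∂`-convex on `D` w.r.t. the convexificator map `sub`. -/
def DConvexOn {n : ℕ} (D : Set (EuclideanSpace ℝ (Fin n)))
    (f : EuclideanSpace ℝ (Fin n) → ℝ)
    (sub : EuclideanSpace ℝ (Fin n) → Set (EuclideanSpace ℝ (Fin n))) : Prop :=
  ∀ ω ∈ D, ∀ v ∈ D, ∀ ζ ∈ sub ω, ⟪ζ, v - ω⟫ ≤ f v - f ω

/-- `f` is strictly `∂`-convex on `D` w.r.t. the convexificator map `sub`. -/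
def StrictDConvexOn {n : ℕ} (D : Set (EuclideanSpace ℝ (Fin n)))
    (f : EuclideanSpace ℝ (Fin n) → ℝ)
    (sub : EuclideanSpace ℝ (Fin n) → Set (EuclideanSpace ℝ (Fin n))) : Prop :=
  ∀ ω ∈ D, ∀ v ∈ D, v ≠ ω → ∀ ζ ∈ sub ω, ⟪ζ, v - ω⟫ < f v - f ω

/-- A convexificator is nonempty: the empty set fails the first inequality at `w = 0`. -/
lemma IsConvexificatorAt.nonempty {n : ℕ} {f : EuclideanSpace ℝ (Fin n) → ℝ}
    {x : EuclideanSpace ℝ (Fin n)} {S : Set (EuclideanSpace ℝ (Fin n))}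
    (h : IsConvexificatorAt f x S) : S.Nonempty := by
  rw [Set.nonempty_iff_ne_empty]
  rintro rfl
  have h0 := h.2.1 0
  simp [diniLower] at h0

open Filter Topology in
lemma LocallyLipschitzOnD.continuousOn {n : ℕ} {D : Set (EuclideanSpace ℝ (Fin n))}
    {f : EuclideanSpace ℝ (Fin n) → ℝ} (h : LocallyLipschitzOnD D f) : ContinuousOn f D := by
  intro x hx
  obtain ⟨M, -, δ, hδ, hM⟩ := h x hx
  have hlim : Tendsto (fun y => M * ‖y - x‖) (𝓝[D] x) (𝓝 0) := by
    have hc : Continuous fun y : EuclideanSpace ℝ (Fin n) => M * ‖y - x‖ := by fun_prop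
    simpa using (hc.tendsto x).mono_left nhdsWithin_le_nhds
  refine tendsto_iff_norm_sub_tendsto_zero.2
    (squeeze_zero' (Eventually.of_forall fun _ => norm_nonneg _) ?_ hlim)
  filter_upwards [self_mem_nhdsWithin, mem_nhdsWithin_of_mem_nhds (Metric.ball_mem_nhds x hδ)]
    with y hyD hy
  exact hM y hyD x hx (by simpa [dist_eq_norm] using hy) (by simpa using hδ)

theorem stmt_13 {n : ℕ} (D : Set (EuclideanSpace ℝ (Fin n)))
    (hne : D.Nonempty) (hconv : Convex ℝ D)
    (f : EuclideanSpace ℝ (Fin n) → ℝ)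
    (sub : EuclideanSpace ℝ (Fin n) → Set (EuclideanSpace ℝ (Fin n)))
    (hlip : LocallyLipschitzOnD D f)
    (hcf : HasBoundedConvexificatorOn D f sub)
    (hcvx : DConvexOn D f sub) :
    ∀ ω ∈ D, ∀ v ∈ D, ω ≠ v →
      ∃ t ∈ Set.Ioo (0 : ℝ) 1, ∃ ζ ∈ convexHull ℝ (sub (ω + t • (v - ω))),
        ⟪ζ, v - ω⟫ ≤ f v - f ω := by
  intro ω hω v hv _
  by_contra! hcon
  set d := v - ω with hd
  have hmem : ∀ t ∈ Set.Icc (0 : ℝ) 1, ω + t • d ∈ D := fun t ht =>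
    hconv.add_smul_sub_mem hω hv ht
  -- every interior subgradient has slope along `d` exceeding the chord slope
  have hslope : ∀ t ∈ Set.Ioo (0 : ℝ) 1, ∀ s ∈ Set.Ioc t 1,
      (s - t) * (f v - f ω) < f (ω + s • d) - f (ω + t • d) := by
    intro t ht s hs
    have hxt := hmem t ⟨ht.1.le, ht.2.le⟩
    obtain ⟨ζ, hζ⟩ := (hcf _ hxt).1.nonempty
    have h1 := hcon t ht ζ (subset_convexHull ℝ _ hζ)
    have h2 := hcvx _ hxt _ (hmem s ⟨(ht.1.trans hs.1).le, hs.2⟩) ζ hζ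
    have h3 : ω + s • d - (ω + t • d) = (s - t) • d := by module
    rw [h3, real_inner_smul_right] at h2
    exact (mul_lt_mul_of_pos_left h1 (sub_pos.2 hs.1)).trans_le h2
  have hright := hslope (1 / 2) (by norm_num) 1 (by norm_num)
  have hcont : Filter.Tendsto (fun t : ℝ => f (ω + t • d)) (nhdsWithin 0 (Set.Ioi 0))
      (nhds (f ω)) := by
    refine (hlip.continuousOn ω hω).tendsto.comp (tendsto_nhdsWithin_iff.2 ⟨?_, ?_⟩)
    · have hc : Continuous fun t : ℝ => ω + t • d := by fun_prop
      simpa using (hc.tendsto 0).mono_left nhdsWithin_le_nhds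
    · filter_upwards [Ioo_mem_nhdsGT (zero_lt_one (α := ℝ))] with t ht
      exact hmem t ⟨ht.1.le, ht.2.le⟩
  have hlin : Filter.Tendsto (fun t : ℝ => (1 / 2 - t) * (f v - f ω))
      (nhdsWithin 0 (Set.Ioi 0)) (nhds ((1 / 2 - 0) * (f v - f ω))) := by
    have hc : Continuous fun t : ℝ => (1 / 2 - t) * (f v - f ω) := by fun_prop
    exact (hc.tendsto 0).mono_left nhdsWithin_le_nhds
  have hleft : (1 / 2 - 0) * (f v - f ω) ≤ f (ω + (1 / 2 : ℝ) • d) - f ω := by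
    refine le_of_tendsto_of_tendsto hlin (hcont.const_sub _) ?_
    filter_upwards [Ioo_mem_nhdsGT (one_half_pos (α := ℝ))] with t ht
    exact (hslope t ⟨ht.1, ht.2.trans one_half_lt_one⟩ (1 / 2) ⟨ht.2, by norm_num⟩).le
  have hend : ω + (1 : ℝ) • d = v := by simp [hd]
  rw [hend] at hright
  linarith
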